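/- (Theorem 4, even case.) Let n be even, and set r_0 = v_0 = \lfloor C(n, n/2-1) \cdot 2^{-n/2-1} \rfloor and z_0 = \lfloor C(n, n/2)/2 \rfloor. Let T(n) be the (nonempty for large even n) set of monotone Boolean functions f of n variables such that: every minimal one of f lies in E^{n,n/2-1}, E^{n,n/2}, or E^{n,n/2+1}; f(x) = 1 for every x with at least n/2+2 ones; f has exactly r_0 minimal ones in E^{n,n/2-1}; f has exactly v_0 maximal zeros in E^{n,n/2+1}; and f takes the value 1 on exactly z_0 vectors of E^{n,n/2} (this is the most probable parameter configuration of a random monotone Boolean function). Then the expected average sensitivity \hat{s}(n) = E[s^f] of f chosen uniformly from T(n) satisfies \hat{s}(n) / ( n \cdot 2^{-n} \cdot C(n, n/2-1) \cdot (2^{-n/2-1} + 1) ) \to 1 as n \to \infty through even values. -/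

import Mathlib

open Finset

/-- `x` with its `j`-th coordinate set to `b`. -/
def setCoord {n : ℕ} (x : Fin n → Bool) (j : Fin n) (b : Bool) : Fin n → Bool :=
  Function.update x j b

/-- `x` with its `j`-th coordinate flipped (`x ⊕ e_j`). -/
def flipCoord {n : ℕ} (x : Fin n → Bool) (j : Fin n) : Fin n → Bool :=
  Function.update x j (!x j)

/-- Number of ones of a Boolean vector. -/
def weight {n : ℕ} (x : Fin n → Bool) : ℕ :=
  (Finset.univ.filter fun i => x i = true).card

/-- The activity `α_j^f = 2^{-n} ∑_x (f(x^{(j,0)}) ⊕ f(x^{(j,1)}))`. -/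
noncomputable def activity {n : ℕ} (f : (Fin n → Bool) → Bool) (j : Fin n) : ℝ :=
  (2 ^ n : ℝ)⁻¹ * ∑ x : Fin n → Bool,
    (if f (setCoord x j false) ≠ f (setCoord x j true) then (1 : ℝ) else 0)

/-- The sensitivity `s^f(x)` of `f` at `x`. -/
def sensAt {n : ℕ} (f : (Fin n → Bool) → Bool) (x : Fin n → Bool) : ℕ :=
  (Finset.univ.filter fun i => f (flipCoord x i) ≠ f x).card

/-- The average sensitivity `s^f`. -/
noncomputable def avgSens {n : ℕ} (f : (Fin n → Bool) → Bool) : ℝ :=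
  (2 ^ n : ℝ)⁻¹ * ∑ x : Fin n → Bool, (sensAt f x : ℝ)

/-- `x` is a minimal one of the (monotone) function `f`. -/
def MinimalOne {n : ℕ} (f : (Fin n → Bool) → Bool) (x : Fin n → Bool) : Prop :=
  f x = true ∧ ∀ y, y < x → f y = false

/-- `x` is a maximal zero of the (monotone) function `f`. -/
def MaximalZero {n : ℕ} (f : (Fin n → Bool) → Bool) (x : Fin n → Bool) : Prop :=
  f x = false ∧ ∀ y, x < y → f y = true

/-- `r_0 = v_0 = ⌊C(n, n/2-1) · 2^{-n/2-1}⌋` (for even `n`). -/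
def r0 (n : ℕ) : ℕ := n.choose (n / 2 - 1) / 2 ^ (n / 2 + 1)

/-- `z_0 = ⌊C(n, n/2)/2⌋`. -/
def z0 (n : ℕ) : ℕ := n.choose (n / 2) / 2

open Classical in
/-- The set of `typical' monotone Boolean functions for even `n`: minimal ones only in the
three middle layers, value `1` from layer `n/2+2` upward, exactly `r_0` minimal ones in
layer `n/2-1`, exactly `v_0 = r_0` maximal zeros in layer `n/2+1`, and value `1` on exactly
`z_0` vertices of the middle layer. -/
noncomputable def typicalEven (n : ℕ) : Finset ((Fin n → Bool) → Bool) :=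
  Finset.univ.filter fun f =>
    Monotone f ∧
    (∀ x, MinimalOne f x →
      weight x = n / 2 - 1 ∨ weight x = n / 2 ∨ weight x = n / 2 + 1) ∧
    (∀ x, n / 2 + 2 ≤ weight x → f x = true) ∧
    {x : Fin n → Bool | MinimalOne f x ∧ weight x = n / 2 - 1}.ncard = r0 n ∧
    {x : Fin n → Bool | MaximalZero f x ∧ weight x = n / 2 + 1}.ncard = r0 n ∧
    {x : Fin n → Bool | f x = true ∧ weight x = n / 2}.ncard = z0 n

/-- The expected average sensitivity of a function drawn uniformly from `T`. -/
noncomputable def expAvgSens {n : ℕ} (T : Finset ((Fin n → Bool) → Bool)) : ℝ :=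
  (∑ f ∈ T, avgSens f) / T.card

/-! ### Weights of Boolean vectors -/

lemma weight_mono {n : ℕ} {x y : Fin n → Bool} (h : x ≤ y) : weight x ≤ weight y := by
  refine Finset.card_le_card fun i => ?_
  simp only [Finset.mem_filter, Finset.mem_univ, true_and]
  intro hi
  have := h i
  rw [hi] at this
  exact top_le_iff.mp this

lemma weight_strictMono {n : ℕ} {x y : Fin n → Bool} (h : x < y) : weight x < weight y := by
  obtain ⟨hle, i, hi⟩ := Pi.lt_def.mp h
  obtain ⟨hx, hy⟩ : x i = false ∧ y i = true := by
    revert hi; cases x i <;> cases y i <;> simp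
  refine Finset.card_lt_card ⟨fun j => ?_, fun hsub => ?_⟩
  · simp only [Finset.mem_filter, Finset.mem_univ, true_and]
    intro hj
    have := hle j
    rw [hj] at this
    exact top_le_iff.mp this
  · have := hsub (show i ∈ Finset.univ.filter fun i => y i = true by simp [hy])
    simp [hx] at this

lemma weight_le {n : ℕ} (x : Fin n → Bool) : weight x ≤ n := by
  simpa [weight] using Finset.card_filter_le (Finset.univ : Finset (Fin n)) fun i => x i = true

lemma weight_indicator {n : ℕ} (s : Finset (Fin n)) :
    weight (fun i => decide (i ∈ s)) = s.card := by
  simp [weight]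

lemma card_weight_eq (n k : ℕ) :
    (Finset.univ.filter fun x : Fin n → Bool => weight x = k).card = n.choose k := by
  have h : (Finset.powersetCard k (Finset.univ : Finset (Fin n))).card = n.choose k := by simp
  rw [← h]
  refine Finset.card_nbij' (fun x => Finset.univ.filter fun i => x i = true)
    (fun s i => decide (i ∈ s)) ?_ ?_ ?_ ?_
  · intro x hx
    simpa [weight] using (Finset.mem_filter.mp hx).2
  · intro s hs
    exact Finset.mem_filter.mpr
      ⟨Finset.mem_univ _, (weight_indicator s).trans (Finset.mem_powersetCard.mp hs).2⟩
  · intro x _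
    ext i
    simp
  · intro s _
    ext i
    simp

lemma weight_not_add {n : ℕ} (x : Fin n → Bool) :
    weight (fun i => !x i) + weight x = n := by
  have := Finset.card_filter_add_card_filter_not (s := (Finset.univ : Finset (Fin n)))
    (fun i => x i = true)
  simp only [Finset.card_univ, Fintype.card_fin, Bool.not_eq_true] at this
  simp only [weight, Bool.not_eq_true']
  omega

lemma two_mul_card_middle_layer_true (m : ℕ) (i : Fin (2 * m)) :
    2 * (Finset.univ.filter fun x : Fin (2 * m) → Bool => x i = true ∧ weight x = m).card
      = (2 * m).choose m := by
  have hflip : (Finset.univ.filter fun x : Fin (2 * m) → Bool => x i = true ∧ weight x = m).card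
      = (Finset.univ.filter fun x : Fin (2 * m) → Bool => ¬ x i = true ∧ weight x = m).card := by
    refine Finset.card_nbij' (fun x j => !x j) (fun x j => !x j) ?_ ?_ ?_ ?_
    · intro x hx
      have := weight_not_add x
      simp at hx ⊢
      exact ⟨hx.1, by omega⟩
    · intro x hx
      have := weight_not_add x
      simp at hx ⊢
      exact ⟨hx.1, by omega⟩
    · intro x _; simp
    · intro x _; simp
  have hsum := Finset.card_filter_add_card_filter_not
    (s := Finset.univ.filter fun x : Fin (2 * m) → Bool => weight x = m) (fun x => x i = true)
  rw [card_weight_eq, Finset.filter_filter, Finset.filter_filter] at hsum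
  simp only [and_comm (a := weight _ = m)] at hsum
  omega

lemma choose_le_card_layer_true_false {n : ℕ} (k : ℕ) {i j : Fin n} (hij : i ≠ j) :
    (n - 2).choose k ≤
      (Finset.univ.filter fun x : Fin n → Bool =>
        weight x = k + 1 ∧ x i = true ∧ x j = false).card := by
  have hcard : (Finset.powersetCard k (Finset.univ \ {i, j} : Finset (Fin n))).card
      = (n - 2).choose k := by
    rw [Finset.card_powersetCard, Finset.card_sdiff_of_subset (Finset.subset_univ _),
      Finset.card_pair hij]
    simp
  rw [← hcard]
  refine Finset.card_le_card_of_injOn (fun s l => decide (l ∈ insert i s)) ?_ ?_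
  · intro s hs
    obtain ⟨hs, hk⟩ := Finset.mem_powersetCard.mp hs
    have hi : i ∉ s := fun h => by simpa using hs h
    have hj : j ∉ s := fun h => by simpa using hs h
    have hw : weight (fun l => decide (l ∈ insert i s)) = k + 1 := by
      rw [weight_indicator, Finset.card_insert_of_notMem hi, hk]
    refine Finset.mem_filter.mpr ⟨Finset.mem_univ _, hw, ?_, ?_⟩
    · simp
    · simp [hj, hij.symm]
  · intro s hs t ht hst
    have hs' := (Finset.mem_powersetCard.mp hs).1
    have ht' := (Finset.mem_powersetCard.mp ht).1
    have hi : i ∉ s := fun h => by simpa using hs' h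
    have hi' : i ∉ t := fun h => by simpa using ht' h
    have hins : insert i s = insert i t := by
      ext l
      simpa using Bool.eq_iff_iff.mp (congrFun hst l)
    rw [← Finset.erase_insert hi, hins, Finset.erase_insert hi']

/-! ### Total sensitivity of a monotone function -/

lemma flipCoord_flipCoord {n : ℕ} (x : Fin n → Bool) (i : Fin n) :
    flipCoord (flipCoord x i) i = x := by
  simp [flipCoord]

lemma sum_sign_eq {n : ℕ} (x : Fin n → Bool) :
    ∑ i, (if x i = true then (1 : ℤ) else -1) = 2 * weight x - n := by
  have h : ∀ i, (if x i = true then (1 : ℤ) else -1) = 2 * (if x i = true then 1 else 0) - 1 := by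
    intro i; split_ifs <;> simp
  simp only [h, Finset.sum_sub_distrib, ← Finset.mul_sum, Finset.sum_boole]
  simp [weight]

lemma Monotone.sensitive_indicator_eq {n : ℕ} {f : (Fin n → Bool) → Bool} (hf : Monotone f)
    (x : Fin n → Bool) (i : Fin n) :
    (if f (flipCoord x i) ≠ f x then (1 : ℤ) else 0) =
      (if f x = true then (if x i = true then 1 else -1) else 0) +
      (if f (flipCoord x i) = true then (if flipCoord x i i = true then 1 else -1) else 0) := by
  have hi : flipCoord x i i = !x i := by simp [flipCoord]
  rw [hi]
  cases hx : x i
  · have hle : x ≤ flipCoord x i := by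
      simp [flipCoord, hx]
    have := hf hle
    revert this
    cases f x <;> cases f (flipCoord x i) <;> simp
  · have hle : flipCoord x i ≤ x := by
      simp [flipCoord, hx]
    have := hf hle
    revert this
    cases f x <;> cases f (flipCoord x i) <;> simp

lemma Monotone.sum_sensAt {n : ℕ} {f : (Fin n → Bool) → Bool} (hf : Monotone f) :
    ∑ x, (sensAt f x : ℤ) = 2 * ∑ x, if f x = true then 2 * (weight x : ℤ) - n else 0 := by
  have hsens : ∀ x, (sensAt f x : ℤ) = ∑ i, if f (flipCoord x i) ≠ f x then (1 : ℤ) else 0 := by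
    intro x
    rw [Finset.sum_boole]
    rfl
  have hflip : ∀ i, ∑ x, (if f (flipCoord x i) = true then
      (if flipCoord x i i = true then (1 : ℤ) else -1) else 0) =
      ∑ x, if f x = true then (if x i = true then (1 : ℤ) else -1) else 0 := fun i =>
    Equiv.sum_comp (Function.Involutive.toPerm (flipCoord · i) (flipCoord_flipCoord · i))
      fun x => if f x = true then (if x i = true then (1 : ℤ) else -1) else 0
  simp only [hsens, hf.sensitive_indicator_eq]
  rw [Finset.sum_comm]
  simp only [Finset.sum_add_distrib, hflip]
  rw [← two_mul, Finset.sum_comm]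
  congr 1
  refine Finset.sum_congr rfl fun x _ => ?_
  split_ifs
  · exact sum_sign_eq x
  · simp

/-! ### Total sensitivity of a typical function -/

lemma sum_Ico_choose_mul_sub (n a b : ℕ) (hab : a ≤ b) :
    ∑ k ∈ Finset.Ico a b, (n.choose k : ℤ) * (2 * k - n) = a * n.choose a - b * n.choose b := by
  induction b, hab using Nat.le_induction with
  | base => simp
  | succ b hab ih =>
    rw [Finset.sum_Ico_succ_top hab, ih]
    have h : (n.choose (b + 1) : ℤ) * (b + 1) = n.choose b * (n - b) := by
      rcases le_or_gt b n with hb | hb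
      · have := Nat.choose_succ_right_eq n b
        zify [hb] at this
        exact this
      · simp [Nat.choose_eq_zero_of_lt hb, Nat.choose_eq_zero_of_lt (Nat.lt_succ_of_lt hb)]
    push_cast
    linarith

lemma sum_upper_layers (m : ℕ) :
    ∑ x : Fin (2 * m) → Bool, (if m + 1 ≤ weight x then 2 * (weight x : ℤ) - (2 * m : ℕ) else 0)
      = m * (2 * m).choose m := by
  rw [← Finset.sum_filter, ← Finset.sum_fiberwise_of_maps_to
    (t := Finset.Ico (m + 1) (2 * m + 1)) (g := weight)]
  · have hlayer : ∀ k ∈ Finset.Ico (m + 1) (2 * m + 1),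
        ∑ x ∈ (Finset.univ.filter fun x : Fin (2 * m) → Bool => m + 1 ≤ weight x) with weight x = k,
          (2 * (weight x : ℤ) - (2 * m : ℕ)) =
        ((2 * m).choose k : ℤ) * (2 * k - (2 * m : ℕ)) := by
      intro k hk
      have hk := (Finset.mem_Ico.mp hk).1
      rw [← card_weight_eq, Finset.filter_filter, ← nsmul_eq_mul]
      have hset : (Finset.univ.filter fun x : Fin (2 * m) → Bool =>
          m + 1 ≤ weight x ∧ weight x = k) = Finset.univ.filter fun x => weight x = k := by
        ext x
        simp only [Finset.mem_filter, Finset.mem_univ, true_and]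
        omega
      rw [hset]
      refine Finset.sum_eq_card_nsmul fun x hx => ?_
      rw [(Finset.mem_filter.mp hx).2]
    rw [Finset.sum_congr rfl hlayer]
    rcases Nat.eq_zero_or_pos m with rfl | hm
    · simp
    rw [sum_Ico_choose_mul_sub _ _ _ (by omega),
      Nat.choose_eq_zero_of_lt (Nat.lt_succ_self (2 * m))]
    have := Nat.choose_succ_right_eq (2 * m) m
    rw [show 2 * m - m = m by omega] at this
    zify at this
    push_cast
    linarith
  · intro x hx
    have := weight_le x
    simp only [Finset.mem_filter, Finset.mem_univ, true_and] at hx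
    exact Finset.mem_Ico.mpr ⟨hx, by omega⟩

lemma exists_minimalOne_le {n : ℕ} {f : (Fin n → Bool) → Bool} {x : Fin n → Bool}
    (hx : f x = true) : ∃ y ≤ x, MinimalOne f y := by
  obtain ⟨y, hyx, hy⟩ := (Set.toFinite {y | f y = true}).exists_le_minimal hx
  refine ⟨y, hyx, hy.prop, fun w hw => ?_⟩
  by_contra hfw
  exact hy.not_prop_of_lt hw (by simpa using hfw)

lemma sum_sensAt_of_mem_typicalEven {m : ℕ} (hm : 1 ≤ m) {f : (Fin (2 * m) → Bool) → Bool}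
    (hf : f ∈ typicalEven (2 * m)) :
    ∑ x, (sensAt f x : ℤ) = 2 * m * (2 * m).choose m - 8 * r0 (2 * m) := by
  simp only [typicalEven, Finset.mem_filter, Finset.mem_univ, true_and,
    show 2 * m / 2 = m by omega] at hf
  obtain ⟨hmono, hmin, htop, hr, hv, -⟩ := hf
  have hlow : ∀ x, f x = true → m - 1 ≤ weight x := by
    intro x hx
    obtain ⟨y, hyx, hy⟩ := exists_minimalOne_le hx
    have := weight_mono hyx
    have := hmin y hy
    omega
  have hones : (Finset.univ.filter fun x => f x = true ∧ weight x = m - 1).card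
      = r0 (2 * m) := by
    rw [← hr, ← Set.ncard_coe_finset]
    congr 1
    ext x
    simp only [Finset.coe_filter, Finset.mem_univ, true_and, Set.mem_ofPred_eq]
    refine ⟨fun ⟨hx, hw⟩ => ⟨⟨hx, fun y hy => ?_⟩, hw⟩, fun ⟨hx, hw⟩ => ⟨hx.1, hw⟩⟩
    by_contra hfy
    have := hlow y (by simpa using hfy)
    have := weight_strictMono hy
    omega
  have hzeros : (Finset.univ.filter fun x => f x = false ∧ weight x = m + 1).card
      = r0 (2 * m) := by
    rw [← hv, ← Set.ncard_coe_finset]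
    congr 1
    ext x
    simp only [Finset.coe_filter, Finset.mem_univ, true_and, Set.mem_ofPred_eq]
    refine ⟨fun ⟨hx, hw⟩ => ⟨⟨hx, fun y hy => htop y ?_⟩, hw⟩, fun ⟨hx, hw⟩ => ⟨hx.1, hw⟩⟩
    have := weight_strictMono hy
    omega
  have hpoint : ∀ x, (if f x = true then 2 * (weight x : ℤ) - (2 * m : ℕ) else 0) =
      (if m + 1 ≤ weight x then 2 * (weight x : ℤ) - (2 * m : ℕ) else 0)
        - 2 * (if f x = true ∧ weight x = m - 1 then 1 else 0)
        - 2 * (if f x = false ∧ weight x = m + 1 then 1 else 0) := by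
    intro x
    have h1 := hlow x
    have h2 := htop x
    cases hfx : f x <;> simp only [hfx, Bool.false_eq_true, forall_const, false_and, true_and,
      if_true, if_false, imp_false, reduceCtorEq] at h1 h2 ⊢ <;> split_ifs <;> omega
  rw [hmono.sum_sensAt, Finset.sum_congr rfl fun x _ => hpoint x, Finset.sum_sub_distrib,
    Finset.sum_sub_distrib, sum_upper_layers, ← Finset.mul_sum, ← Finset.mul_sum,
    Finset.sum_boole, Finset.sum_boole, hones, hzeros]
  ring

/-! ### Existence of typical functions -/

lemma r0_two_mul_le {m : ℕ} (hm : 2 ≤ m) : r0 (2 * m) ≤ (2 * m - 2).choose (m - 2) := by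
  obtain ⟨k, rfl⟩ : ∃ k, m = k + 2 := ⟨m - 2, by omega⟩
  rw [r0, show 2 * (k + 2) / 2 = k + 2 by omega, show k + 2 - 1 = k + 1 by omega,
    show 2 * (k + 2) - 2 = 2 * k + 2 by omega, show k + 2 - 2 = k by omega,
    show 2 * (k + 2) = 2 * k + 2 + 1 + 1 by omega]
  have hpascal : (2 * k + 2 + 1 + 1).choose (k + 1) =
      (2 * k + 2).choose (k + 1) + (2 * k + 2).choose k + (2 * k + 2 + 1).choose k := by
    rw [Nat.choose_succ_succ, Nat.choose_succ_succ (2 * k + 2) k]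
    ring
  have hcentral : (2 * k + 2).choose (k + 1) ≤ 2 * (2 * k + 2).choose k := by
    have := Nat.choose_succ_right_eq (2 * k + 2) k
    rw [show 2 * k + 2 - k = k + 2 by omega] at this
    nlinarith
  have hbelow : (2 * k + 2 + 1).choose k ≤ 2 * (2 * k + 2).choose k := by
    rcases k with _ | k
    · simp
    · rw [Nat.choose_succ_succ]
      have := Nat.choose_le_succ_of_lt_half_left (r := k) (n := 2 * (k + 1) + 2) (by omega)
      simp only [Nat.succ_eq_add_one] at *
      omega
  have hpow : 8 ≤ 2 ^ (k + 2 + 1) := by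
    have : 1 ≤ 2 ^ k := Nat.one_le_two_pow
    rw [pow_add, pow_add]
    omega
  refine Nat.div_le_of_le_mul ?_
  calc _ ≤ 8 * (2 * k + 2).choose k := by omega
    _ ≤ _ := Nat.mul_le_mul_right _ hpow

lemma weight_update_false {n : ℕ} {x : Fin n → Bool} {i : Fin n} (hi : x i = true) :
    weight (Function.update x i false) + 1 = weight x := by
  have h : (Finset.univ.filter fun j => Function.update x i false j = true) =
      (Finset.univ.filter fun j => x j = true).erase i := by
    ext j
    by_cases hj : j = i <;> simp [Function.update_apply, hj]
  rw [weight, h]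
  exact Finset.card_erase_add_one (by simp [hi])

lemma typicalEven_nonempty {m : ℕ} (hm : 2 ≤ m) : (typicalEven (2 * m)).Nonempty := by
  classical
  let p : Fin (2 * m) := ⟨0, by omega⟩
  let q : Fin (2 * m) := ⟨1, by omega⟩
  have hpq : p ≠ q := by simp [p, q]
  obtain ⟨A, hA, hAcard⟩ := Finset.exists_subset_card_eq
    ((r0_two_mul_le hm).trans (choose_le_card_layer_true_false (m - 2) hpq))
  have hchoose : (2 * m - 2).choose (m - 2) = (2 * m - 2).choose m := by
    rw [← Nat.choose_symm (show m ≤ 2 * m - 2 by omega)]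
    congr 1
    omega
  obtain ⟨B, hB, hBcard⟩ := Finset.exists_subset_card_eq
    ((hchoose ▸ r0_two_mul_le hm).trans (choose_le_card_layer_true_false m hpq.symm))
  have hAw : ∀ x ∈ A, weight x = m - 1 ∧ x p = true := fun x hx => by
    have := hA hx
    simp only [Finset.mem_filter, Finset.mem_univ, true_and] at this
    exact ⟨by omega, this.2.1⟩
  have hBw : ∀ x ∈ B, weight x = m + 1 ∧ x q = true ∧ x p = false := fun x hx => by
    simpa using hB hx
  let f : (Fin (2 * m) → Bool) → Bool := fun x => decide (m + 2 ≤ weight x ∨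
    (weight x = m + 1 ∧ x ∉ B) ∨ (x p = true ∧ weight x = m) ∨ x ∈ A)
  have hf : ∀ x, f x = true ↔ (m + 2 ≤ weight x ∨
    (weight x = m + 1 ∧ x ∉ B) ∨ (x p = true ∧ weight x = m) ∨ x ∈ A) := fun x => by simp [f]
  have hlow : ∀ x, f x = true → m - 1 ≤ weight x := fun x hx => by
    rcases (hf x).mp hx with h | h | h | h
    · omega
    · omega
    · omega
    · exact (hAw x h).1.ge
  refine ⟨f, ?_⟩
  simp only [typicalEven, Finset.mem_filter, Finset.mem_univ, true_and,
    show 2 * m / 2 = m by omega]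
  refine ⟨?_, ?_, fun x hx => (hf x).mpr (Or.inl hx), ?_, ?_, ?_⟩
  · intro x y hxy
    rcases hxy.eq_or_lt with rfl | hlt
    · exact le_rfl
    refine Bool.le_iff_imp.mpr fun hx => (hf y).mpr ?_
    have hw := weight_strictMono hlt
    have hyp : x p = true → y p = true := Bool.le_iff_imp.mp (hxy p)
    have hyB : y p = true → y ∉ B := fun h hy => by simp [(hBw y hy).2.2] at h
    rcases (hf x).mp hx with h | h | h | h
    · exact Or.inl (by omega)
    · exact Or.inl (by omega)
    · rcases Nat.lt_or_ge (weight y) (m + 2) with hy | hy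
      · exact Or.inr (Or.inl ⟨by omega, hyB (hyp h.1)⟩)
      · exact Or.inl hy
    · obtain ⟨hxw, hxp⟩ := hAw x h
      rcases Nat.lt_or_ge (weight y) (m + 2) with hy | hy
      · rcases Nat.lt_or_ge (weight y) (m + 1) with hy' | hy'
        · exact Or.inr (Or.inr (Or.inl ⟨hyp hxp, by omega⟩))
        · exact Or.inr (Or.inl ⟨by omega, hyB (hyp hxp)⟩)
      · exact Or.inl hy
  · intro x hx
    have h1 := hlow x hx.1
    by_contra hne
    have hw : m + 2 ≤ weight x := by omega
    -- Clearing coordinate `q`, or any coordinate if `q` is already clear, avoids `B`.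
    obtain ⟨i, hi, hiq⟩ : ∃ i, x i = true ∧ Function.update x i false q = false := by
      cases hq : x q
      · have hpos : 0 < weight x := by omega
        obtain ⟨i, hi⟩ := Finset.card_pos.mp hpos
        have hi : x i = true := by simpa using hi
        refine ⟨i, hi, ?_⟩
        rw [Function.update_of_ne (fun h => by simp [← h, hq] at hi), hq]
      · exact ⟨q, hq, by simp⟩
    have hwu := weight_update_false hi
    have hlt : Function.update x i false < x := by
      refine lt_of_le_of_ne (by simp) fun h => ?_
      rw [h] at hwu
      omega
    have hzero := hx.2 _ hlt
    have hone : f (Function.update x i false) = true := by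
      refine (hf _).mpr ?_
      rcases Nat.lt_or_ge (weight x) (m + 3) with h | h
      · refine Or.inr (Or.inl ⟨by omega, fun hmem => ?_⟩)
        have := (hBw _ hmem).2.1
        simp [hiq] at this
      · exact Or.inl (by omega)
    simp [hone] at hzero
  · rw [← hAcard, ← Set.ncard_coe_finset]
    congr 1
    ext x
    simp only [Set.mem_ofPred_eq, Finset.mem_coe]
    constructor
    · rintro ⟨hx, hw⟩
      rcases (hf x).mp hx.1 with h | h | h | h
      · omega
      · omega
      · omega
      · exact h
    · intro hx
      have hw := (hAw x hx).1
      refine ⟨⟨(hf x).mpr (Or.inr (Or.inr (Or.inr hx))), fun y hy => ?_⟩, hw⟩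
      by_contra hfy
      have := hlow y (by simpa using hfy)
      have := weight_strictMono hy
      omega
  · rw [← hBcard, ← Set.ncard_coe_finset]
    congr 1
    ext x
    simp only [Set.mem_ofPred_eq, Finset.mem_coe]
    constructor
    · rintro ⟨hx, hw⟩
      by_contra hxB
      have := (hf x).mpr (Or.inr (Or.inl ⟨hw, hxB⟩))
      simp [hx.1] at this
    · intro hx
      have hw := (hBw x hx).1
      refine ⟨⟨?_, fun y hy => (hf y).mpr (Or.inl ?_)⟩, hw⟩
      · by_contra hfx
        rcases (hf x).mp (by simpa using hfx) with h | h | h | h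
        · omega
        · exact h.2 hx
        · omega
        · have := (hAw x h).1
          omega
      · have := weight_strictMono hy
        omega
  · have hcount := two_mul_card_middle_layer_true m p
    rw [z0, show 2 * m / 2 = m by omega, ← hcount, Nat.mul_div_cancel_left _ (by norm_num),
      ← Set.ncard_coe_finset]
    congr 1
    ext x
    simp only [Set.mem_ofPred_eq, Finset.coe_filter, Finset.mem_univ, true_and]
    refine ⟨fun ⟨hx, hw⟩ => ?_, fun h => ⟨(hf x).mpr (Or.inr (Or.inr (Or.inl h))), h.2⟩⟩
    rcases (hf x).mp hx with h | h | h | h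
    · omega
    · omega
    · exact h
    · have := (hAw x h).1
      omega

/-! ### The expected average sensitivity -/

lemma expAvgSens_typicalEven {m : ℕ} (hm : 2 ≤ m) :
    expAvgSens (typicalEven (2 * m)) =
      ((2 : ℝ) ^ (2 * m))⁻¹ * (2 * m * (2 * m).choose m - 8 * r0 (2 * m)) := by
  have hcard : ((typicalEven (2 * m)).card : ℝ) ≠ 0 := by
    exact_mod_cast (typicalEven_nonempty hm).card_pos.ne'
  rw [expAvgSens, Finset.sum_eq_card_nsmul (b := ((2 : ℝ) ^ (2 * m))⁻¹ *
    (2 * m * (2 * m).choose m - 8 * r0 (2 * m))), nsmul_eq_mul, mul_div_cancel_left₀ _ hcard]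
  intro f hf
  have := sum_sensAt_of_mem_typicalEven (by omega) hf
  rw [avgSens]
  congr 1
  exact_mod_cast congrArg (Int.cast : ℤ → ℝ) this

lemma expAvgSens_ratio {m : ℕ} (hm : 2 ≤ m) (c : ℝ) :
    expAvgSens (typicalEven (2 * m)) /
        (((2 * m : ℕ) : ℝ) * ((2 : ℝ) ^ (2 * m))⁻¹ * ((2 * m).choose (m - 1) : ℝ) * c) =
      (1 + 1 / m - 4 / m * (r0 (2 * m) / (2 * m).choose (m - 1))) / c := by
  have hm0 : (m : ℝ) ≠ 0 := by
    have : m ≠ 0 := by omega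
    exact_mod_cast this
  have hM : ((2 * m).choose (m - 1) : ℝ) ≠ 0 := by
    exact_mod_cast (Nat.choose_pos (show m - 1 ≤ 2 * m by omega)).ne'
  have hN : ((2 * m).choose m : ℝ) * m = (2 * m).choose (m - 1) * (m + 1) := by
    have := Nat.choose_succ_right_eq (2 * m) (m - 1)
    rw [show m - 1 + 1 = m by omega, show 2 * m - (m - 1) = m + 1 by omega] at this
    exact_mod_cast this
  rw [expAvgSens_typicalEven hm, ← div_div]
  congr 1
  have h2 : ((2 : ℝ) ^ (2 * m)) ≠ 0 := by positivity
  push_cast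
  field_simp
  linear_combination 2 * hN

/-- Theorem 4, even case:
`E[s^f] ∼ n 2^{-n} C(n, n/2-1) (2^{-n/2-1} + 1)` as `n → ∞` through even values. -/
theorem expected_avgSens_even :
    Filter.Tendsto
      (fun n : ℕ => expAvgSens (typicalEven n) /
        ((n : ℝ) * ((2 : ℝ) ^ n)⁻¹ * (n.choose (n / 2 - 1) : ℝ) *
          (((2 : ℝ) ^ (n / 2 + 1))⁻¹ + 1)))
      (Filter.atTop ⊓ Filter.principal {n : ℕ | Even n}) (nhds 1) := by
  have hhalf : Filter.Tendsto (fun n : ℕ => n / 2) Filter.atTop Filter.atTop :=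
    Nat.tendsto_div_const_atTop (by norm_num)
  have hpow : Filter.Tendsto (fun m : ℕ => ((2 : ℝ) ^ (m + 1))⁻¹ + 1) Filter.atTop (nhds 1) := by
    have h := (tendsto_pow_atTop_atTop_of_one_lt (one_lt_two (α := ℝ))).comp
      (Filter.tendsto_add_atTop_nat 1)
    simpa using h.inv_tendsto_atTop.add_const 1
  have hbound : ∀ c : ℝ, Filter.Tendsto
      (fun m : ℕ => (1 + c / m) / (((2 : ℝ) ^ (m + 1))⁻¹ + 1)) Filter.atTop (nhds 1) := by
    intro c
    have h := ((tendsto_const_div_atTop_nhds_zero_nat c).const_add 1).div hpow one_ne_zero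
    rw [add_zero, div_one] at h
    exact h
  refine tendsto_of_tendsto_of_tendsto_of_le_of_le'
    (((hbound (-3)).comp hhalf).mono_left inf_le_left)
    (((hbound 1).comp hhalf).mono_left inf_le_left) ?_ ?_
  all_goals
    rw [Filter.eventually_inf_principal]
    filter_upwards [Filter.eventually_ge_atTop 4] with n hn hev
    obtain ⟨m, rfl⟩ := hev.two_dvd
    have hm : 2 ≤ m := by omega
    have hm0 : (0 : ℝ) < m := by
      have : 0 < m := by omega
      exact_mod_cast this
    have hr0 : (0 : ℝ) ≤ r0 (2 * m) / (2 * m).choose (m - 1) := by positivity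
    have hr1 : (r0 (2 * m) : ℝ) / (2 * m).choose (m - 1) ≤ 1 := by
      refine div_le_one_of_le₀ ?_ (by positivity)
      rw [r0, show 2 * m / 2 = m by omega]
      exact_mod_cast Nat.div_le_self _ _
    simp only [Function.comp, show 2 * m / 2 = m by omega]
    rw [expAvgSens_ratio hm]
    have h4 : (0 : ℝ) < 4 / m := by positivity
    gcongr
  · have : (-3 : ℝ) / m = 1 / m - 4 / m := by ring
    nlinarith
  · nlinarith
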